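/- arXiv:2105.07963 — 3 statements merged into one kernel-verified Lean document; each statement's English description precedes it below -/
import Mathlib

section
/- Let X be a real Hilbert space and let b : X × X → ℝ be a bilinear form such that there exist constants M > 0 and β > 0 with |b(v, u)| ≤ M‖u‖_X‖v‖_X for all u, v ∈ X and β‖u‖_X² ≤ |b(u, u)| for all u ∈ X. Let q₁, …, q_N ∈ X be linearly independent and let B_h ∈ ℝ^{N×N} be the matrix with entries (B_h)[i,j] = b(q_j, q_i). Then B_h is invertible and its condition number satisfies κ(B_h) ≤ (M/β) · (κ(Q))², where κ(Q) = σ_max(Q)/σ_min(Q). -/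
open scoped RealInnerProductSpace

/-- Spectral norm (2-norm) of a real square matrix: the operator norm of the
induced linear map on Euclidean space. -/
noncomputable def specNorm {N : ℕ} (A : Matrix (Fin N) (Fin N) ℝ) : ℝ :=
  ‖Matrix.toEuclideanCLM (𝕜 := ℝ) A‖

/-- Condition number κ(A) = ‖A‖₂ ‖A⁻¹‖₂ of a real square matrix. -/
noncomputable def condNum {N : ℕ} (A : Matrix (Fin N) (Fin N) ℝ) : ℝ :=
  specNorm A * specNorm A⁻¹

/-- σ_max(Q) for a family of vectors q₁,…,q_N in an inner product space:
the supremum of ‖Σ vℓ qℓ‖ over Euclidean-unit vectors v. -/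
noncomputable def sigmaMax {X : Type*} [NormedAddCommGroup X] [InnerProductSpace ℝ X]
    {N : ℕ} (q : Fin N → X) : ℝ :=
  sSup {r : ℝ | ∃ v : EuclideanSpace ℝ (Fin N), ‖v‖ = 1 ∧ r = ‖∑ ℓ, v ℓ • q ℓ‖}

/-- σ_min(Q) for a family of vectors q₁,…,q_N in an inner product space:
the infimum of ‖Σ vℓ qℓ‖ over Euclidean-unit vectors v. -/
noncomputable def sigmaMin {X : Type*} [NormedAddCommGroup X] [InnerProductSpace ℝ X]
    {N : ℕ} (q : Fin N → X) : ℝ :=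
  sInf {r : ℝ | ∃ v : EuclideanSpace ℝ (Fin N), ‖v‖ = 1 ∧ r = ‖∑ ℓ, v ℓ • q ℓ‖}

/-- κ(Q) = σ_max(Q) / σ_min(Q). -/
noncomputable def kappaQ {X : Type*} [NormedAddCommGroup X] [InnerProductSpace ℝ X]
    {N : ℕ} (q : Fin N → X) : ℝ :=
  sigmaMax q / sigmaMin q

noncomputable def synthL {X : Type*} [NormedAddCommGroup X] [InnerProductSpace ℝ X]
    {N : ℕ} (q : Fin N → X) : EuclideanSpace ℝ (Fin N) →ₗ[ℝ] X where
  toFun v := ∑ ℓ, v ℓ • q ℓ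
  map_add' u v := by simp [add_smul, Finset.sum_add_distrib]
  map_smul' c v := by simp [Finset.smul_sum, mul_smul]

theorem synthL_apply {X : Type*} [NormedAddCommGroup X] [InnerProductSpace ℝ X]
    {N : ℕ} (q : Fin N → X) (v : EuclideanSpace ℝ (Fin N)) :
    synthL q v = ∑ ℓ, v ℓ • q ℓ := rfl

theorem synthL_unit {X : Type*} [NormedAddCommGroup X] [InnerProductSpace ℝ X]
    {N : ℕ} (q : Fin N → X) (v : EuclideanSpace ℝ (Fin N)) (hv : v ≠ 0) :
    ‖v‖⁻¹ * ‖synthL q v‖ ∈ {r : ℝ | ∃ v : EuclideanSpace ℝ (Fin N), ‖v‖ = 1 ∧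
      r = ‖∑ ℓ, v ℓ • q ℓ‖} := by
  have h : ‖v‖ ≠ 0 := norm_ne_zero_iff.2 hv
  refine ⟨‖v‖⁻¹ • v, by rw [norm_smul, norm_inv, norm_norm, inv_mul_cancel₀ h], ?_⟩
  rw [← synthL_apply, map_smul, norm_smul, norm_inv, norm_norm]

theorem synthL_le {X : Type*} [NormedAddCommGroup X] [InnerProductSpace ℝ X]
    {N : ℕ} (q : Fin N → X) (v : EuclideanSpace ℝ (Fin N)) :
    ‖synthL q v‖ ≤ sigmaMax q * ‖v‖ := by
  by_cases hv : v = 0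
  · simp [hv]
  have hp : 0 < ‖v‖ := norm_pos_iff.2 hv
  have h : ‖v‖⁻¹ * ‖synthL q v‖ ≤ sigmaMax q := by
    refine le_csSup ⟨‖(synthL q).toContinuousLinearMap‖, ?_⟩ (synthL_unit q v hv)
    rintro r ⟨w, hw, rfl⟩
    have := (synthL q).toContinuousLinearMap.le_opNorm w
    rw [hw, mul_one] at this
    exact this
  rwa [inv_mul_le_iff₀ hp, mul_comm] at h

theorem le_synthL {X : Type*} [NormedAddCommGroup X] [InnerProductSpace ℝ X]
    {N : ℕ} (q : Fin N → X) (v : EuclideanSpace ℝ (Fin N)) :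
    sigmaMin q * ‖v‖ ≤ ‖synthL q v‖ := by
  by_cases hv : v = 0
  · simp [hv]
  have hp : 0 < ‖v‖ := norm_pos_iff.2 hv
  have h : sigmaMin q ≤ ‖v‖⁻¹ * ‖synthL q v‖ := by
    refine csInf_le ⟨0, ?_⟩ (synthL_unit q v hv)
    rintro r ⟨w, hw, rfl⟩
    positivity
  rwa [le_inv_mul_iff₀ hp, mul_comm] at h

theorem sigmaMin_pos {X : Type*} [NormedAddCommGroup X] [InnerProductSpace ℝ X]
    {N : ℕ} (q : Fin N → X) (hq : LinearIndependent ℝ q)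
    (w : EuclideanSpace ℝ (Fin N)) (hw : w ≠ 0) : 0 < sigmaMin q := by
  have hker : LinearMap.ker (synthL q) = ⊥ := by
    rw [LinearMap.ker_eq_bot']
    intro v hv
    ext i
    exact Fintype.linearIndependent_iff.1 hq (fun i => v i) hv i
  obtain ⟨K, hK, hA⟩ := (synthL q).exists_antilipschitzWith hker
  have hK' : (0 : ℝ) < K := hK
  refine lt_of_lt_of_le (inv_pos.2 hK') (le_csInf ⟨_, synthL_unit q w hw⟩ ?_)
  rintro r ⟨v, hv, rfl⟩
  have := hA.le_mul_dist v 0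
  rw [map_zero, dist_zero_right, dist_zero_right, hv] at this
  rw [inv_le_iff_one_le_mul₀' hK']
  exact this

theorem inner_synth {X : Type*} [NormedAddCommGroup X] [InnerProductSpace ℝ X]
    (b : X →ₗ[ℝ] X →ₗ[ℝ] ℝ)
    {N : ℕ} (q : Fin N → X)
    (Bh : Matrix (Fin N) (Fin N) ℝ)
    (hBh : ∀ i j, Bh i j = b (q j) (q i)) (v w : EuclideanSpace ℝ (Fin N)) :
    inner ℝ w (Matrix.toEuclideanCLM (𝕜 := ℝ) Bh v) = b (synthL q v) (synthL q w) := by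
  simp only [synthL_apply, map_sum, map_smul, LinearMap.sum_apply, LinearMap.smul_apply,
    PiLp.inner_apply, Matrix.ofLp_toEuclideanCLM, Matrix.mulVec, dotProduct, hBh, smul_eq_mul,
    RCLike.inner_apply, conj_trivial, Finset.sum_mul, Finset.mul_sum]
  first
  | (refine Finset.sum_congr rfl fun i _ => Finset.sum_congr rfl fun j _ => ?_
     ring)
  | (rw [Finset.sum_comm]
     refine Finset.sum_congr rfl fun i _ => Finset.sum_congr rfl fun j _ => ?_
     ring)

/-- For a bounded and coercive bilinear form `b` on a real Hilbert
space `X` and linearly independent `q₁,…,q_N`, the matrix `(B_h)[i,j] = b(q_j, q_i)`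
is invertible with κ(B_h) ≤ (M/β)·κ(Q)². -/
theorem fop_bilinear_condition_number
    {X : Type*} [NormedAddCommGroup X] [InnerProductSpace ℝ X] [CompleteSpace X]
    (b : X →ₗ[ℝ] X →ₗ[ℝ] ℝ) (M β : ℝ) (hM : 0 < M) (hβ : 0 < β)
    (hbound : ∀ u v : X, |b v u| ≤ M * ‖u‖ * ‖v‖)
    (hcoer : ∀ u : X, β * ‖u‖ ^ 2 ≤ |b u u|)
    {N : ℕ} (q : Fin N → X) (hq : LinearIndependent ℝ q)
    (Bh : Matrix (Fin N) (Fin N) ℝ)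
    (hBh : ∀ i j, Bh i j = b (q j) (q i)) :
    IsUnit Bh.det ∧ condNum Bh ≤ (M / β) * (kappaQ q) ^ 2 := by
  have hin := inner_synth b q Bh hBh
  set T := Matrix.toEuclideanCLM (𝕜 := ℝ) Bh with hT
  set s := sigmaMin q with hs
  set S := sigmaMax q with hS
  have hlow : ∀ v, β * s ^ 2 * ‖v‖ ≤ ‖T v‖ := by
    intro v
    by_cases hv : v = 0
    · simp [hv]
    have hp : 0 < ‖v‖ := norm_pos_iff.2 hv
    have hsp : 0 < s := sigmaMin_pos q hq v hv
    have h1 := hcoer (synthL q v)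
    rw [← hin] at h1
    have h2 := abs_real_inner_le_norm v (T v)
    have h3 : (s * ‖v‖) ^ 2 ≤ ‖synthL q v‖ ^ 2 :=
      pow_le_pow_left₀ (by positivity) (le_synthL q v) 2
    have h4 := mul_le_mul_of_nonneg_left h3 hβ.le
    refine le_of_mul_le_mul_left ?_ hp
    nlinarith
  have hup : ∀ v, ‖T v‖ ≤ M * S ^ 2 * ‖v‖ := by
    intro v
    by_cases hv : T v = 0
    · rw [hv, norm_zero]; positivity
    have hp : 0 < ‖T v‖ := norm_pos_iff.2 hv
    have h1 := hbound (synthL q (T v)) (synthL q v)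
    rw [← hin, real_inner_self_eq_norm_sq, abs_of_nonneg (by positivity)] at h1
    have h2 : ‖synthL q (T v)‖ * ‖synthL q v‖ ≤ (S * ‖T v‖) * (S * ‖v‖) :=
      mul_le_mul (synthL_le q _) (synthL_le q _) (norm_nonneg _)
        ((norm_nonneg _).trans (synthL_le q _))
    have h3 := mul_le_mul_of_nonneg_left h2 hM.le
    refine le_of_mul_le_mul_left ?_ hp
    nlinarith
  have hdet : IsUnit Bh.det := by
    rw [isUnit_iff_ne_zero]
    intro h0
    obtain ⟨v, hv, hBv⟩ := Matrix.exists_mulVec_eq_zero_iff.2 h0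
    have hv' : WithLp.toLp 2 v ≠ 0 := by simpa using hv
    have h1 := hlow (WithLp.toLp 2 v)
    have h2 : T (WithLp.toLp 2 v) = 0 := by
      rw [hT, Matrix.toEuclideanCLM_toLp, hBv]; rfl
    rw [h2, norm_zero] at h1
    have hsp : 0 < s := sigmaMin_pos q hq _ hv'
    have hp := norm_pos_iff.2 hv'
    have : 0 < β * s ^ 2 * ‖WithLp.toLp 2 v‖ := by positivity
    linarith
  refine ⟨hdet, ?_⟩
  have hn1 : specNorm Bh ≤ M * S ^ 2 :=
    ContinuousLinearMap.opNorm_le_bound _ (by positivity) hup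
  have hn2 : specNorm Bh⁻¹ ≤ (β * s ^ 2)⁻¹ := by
    refine ContinuousLinearMap.opNorm_le_bound _ (by positivity) fun w => ?_
    by_cases hw : w = 0
    · simp [hw]
    have hsp : 0 < s := sigmaMin_pos q hq _ hw
    have h1 := hlow (Matrix.toEuclideanCLM (𝕜 := ℝ) Bh⁻¹ w)
    have h2 : T (Matrix.toEuclideanCLM (𝕜 := ℝ) Bh⁻¹ w) = w := by
      rw [hT, ← ContinuousLinearMap.mul_apply, ← map_mul, Matrix.mul_nonsing_inv _ hdet, map_one]
      rfl
    rw [h2] at h1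
    rw [le_inv_mul_iff₀ (by positivity)]
    exact h1
  calc condNum Bh ≤ (M * S ^ 2) * (β * s ^ 2)⁻¹ :=
        mul_le_mul hn1 hn2 (norm_nonneg _) (by positivity)
    _ = (M / β) * (kappaQ q) ^ 2 := by
        rw [kappaQ, ← hs, ← hS, div_pow, mul_inv, div_eq_mul_inv, div_eq_mul_inv]
        ring
end

section
/- Let X be a real Hilbert space, b : X × X → ℝ a bilinear form, and β > 0 a constant such that β‖u‖_X² ≤ |b(u, u)| for all u ∈ X. Let q₁, …, q_N ∈ X be linearly independent and let B_h ∈ ℝ^{N×N} have entries (B_h)[i,j] = b(q_j, q_i). Then for every v ∈ ℝ^N with ‖v‖₂ = 1 one has ‖B_h v‖₂ ≥ β·σ_min(Q)²; consequently the smallest singular value of B_h satisfies σ_min(B_h) ≥ β·σ_min(Q)². -/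
open scoped RealInnerProductSpace

/-- Smallest singular value of a real square matrix: the infimum of ‖Bv‖₂ over
Euclidean-unit vectors v. -/
noncomputable def matSigmaMin {N : ℕ} (B : Matrix (Fin N) (Fin N) ℝ) : ℝ :=
  sInf {r : ℝ | ∃ v : EuclideanSpace ℝ (Fin N), ‖v‖ = 1 ∧
    r = ‖Matrix.toEuclideanCLM (𝕜 := ℝ) B v‖}

/-- For a coercive bilinear form `b` on a real Hilbert space and
linearly independent `q₁,…,q_N`, the Galerkin matrix `(B_h)[i,j] = b(q_j, q_i)`
satisfies ‖B_h v‖₂ ≥ β σ_min(Q)² for all unit vectors v, hence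
σ_min(B_h) ≥ β σ_min(Q)². -/
theorem fop_bilinear_sigma_min_bound
    {X : Type*} [NormedAddCommGroup X] [InnerProductSpace ℝ X] [CompleteSpace X]
    (b : X →ₗ[ℝ] X →ₗ[ℝ] ℝ) (β : ℝ) (hβ : 0 < β)
    (hcoer : ∀ u : X, β * ‖u‖ ^ 2 ≤ |b u u|)
    {N : ℕ} (q : Fin N → X) (hq : LinearIndependent ℝ q)
    (Bh : Matrix (Fin N) (Fin N) ℝ)
    (hBh : ∀ i j, Bh i j = b (q j) (q i)) :
    (∀ v : EuclideanSpace ℝ (Fin N), ‖v‖ = 1 →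
      β * (sigmaMin q) ^ 2 ≤ ‖Matrix.toEuclideanCLM (𝕜 := ℝ) Bh v‖) ∧
    β * (sigmaMin q) ^ 2 ≤ matSigmaMin Bh := by
  have key : ∀ v : EuclideanSpace ℝ (Fin N), ‖v‖ = 1 →
      β * (sigmaMin q) ^ 2 ≤ ‖Matrix.toEuclideanCLM (𝕜 := ℝ) Bh v‖ := by
    intro v hv
    have h0 : 0 ≤ sigmaMin q := by
      apply Real.sInf_nonneg
      rintro r ⟨w, -, rfl⟩
      exact norm_nonneg _
    have h1 : sigmaMin q ≤ ‖∑ ℓ, v ℓ • q ℓ‖ := by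
      apply csInf_le
      · refine ⟨0, ?_⟩
        rintro r ⟨w, -, rfl⟩
        exact norm_nonneg _
      · exact ⟨v, hv, rfl⟩
    have h2 : b (∑ ℓ, v ℓ • q ℓ) (∑ ℓ, v ℓ • q ℓ)
        = inner ℝ v (Matrix.toEuclideanCLM (𝕜 := ℝ) Bh v) := by
      have e : ∀ i, (Matrix.toEuclideanCLM (𝕜 := ℝ) Bh v) i = ∑ j, Bh i j * v j := by
        intro i
        simp [Matrix.ofLp_toEuclideanCLM, Matrix.mulVec, dotProduct]
      rw [PiLp.inner_apply]
      simp only [e, hBh, map_sum, map_smul, LinearMap.sum_apply, LinearMap.smul_apply,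
        smul_eq_mul, RCLike.inner_apply, conj_trivial, Finset.sum_mul, Finset.mul_sum]
      refine Finset.sum_congr rfl fun i _ => Finset.sum_congr rfl fun j _ => ?_
      ring
    have h3 := abs_real_inner_le_norm v (Matrix.toEuclideanCLM (𝕜 := ℝ) Bh v)
    rw [← h2, hv, one_mul] at h3
    have h4 : (sigmaMin q) ^ 2 ≤ ‖∑ ℓ, v ℓ • q ℓ‖ ^ 2 := pow_le_pow_left₀ h0 h1 2
    exact (mul_le_mul_of_nonneg_left h4 hβ.le).trans ((hcoer _).trans h3)
  refine ⟨key, ?_⟩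
  rcases Nat.eq_zero_or_pos N with rfl | hN
  · have hv : ∀ v : EuclideanSpace ℝ (Fin 0), ‖v‖ ≠ 1 := by
      intro v
      rw [Subsingleton.elim v 0]
      simp
    simp [sigmaMin, matSigmaMin, hv]
  · apply le_csInf
    · exact ⟨_, EuclideanSpace.single ⟨0, hN⟩ (1 : ℝ), by simp, rfl⟩
    · rintro r ⟨v, hv, rfl⟩
      exact key v hv
end

section
/- Let X be a real Hilbert space and K : X → X a bounded linear operator such that there exist constants M_K > 0 and β_K > −1 with ⟨u, K v⟩_X ≤ M_K‖u‖_X‖v‖_X for all u, v ∈ X and β_K‖u‖_X² ≤ ⟨u, K u⟩_X for all u ∈ X. Let q₁, …, q_N ∈ X be linearly independent and let L̃_h ∈ ℝ^{N×N} be the Galerkin matrix with entries (L̃_h)[i,j] = ⟨q_i, q_j + K q_j⟩_X. Then L̃_h is invertible and κ(L̃_h) ≤ ((1 + M_K)/(1 + β_K)) · (κ(Q))². -/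
open scoped RealInnerProductSpace

theorem aux_norm_le {X : Type*} [NormedAddCommGroup X] [InnerProductSpace ℝ X]
    {N : ℕ} (S : EuclideanSpace ℝ (Fin N) →L[ℝ] X) (v : EuclideanSpace ℝ (Fin N)) (hv : v ≠ 0) :
    ‖S v‖ ≤ sSup {r : ℝ | ∃ v : EuclideanSpace ℝ (Fin N), ‖v‖ = 1 ∧ r = ‖S v‖} * ‖v‖ ∧
    sInf {r : ℝ | ∃ v : EuclideanSpace ℝ (Fin N), ‖v‖ = 1 ∧ r = ‖S v‖} * ‖v‖ ≤ ‖S v‖ := by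
  have hv0 : 0 < ‖v‖ := norm_pos_iff.mpr hv
  have hmem : ‖S v‖ / ‖v‖ ∈ {r : ℝ | ∃ v : EuclideanSpace ℝ (Fin N), ‖v‖ = 1 ∧ r = ‖S v‖} := by
    refine ⟨‖v‖⁻¹ • v, ?_, ?_⟩
    · rw [norm_smul, norm_inv, norm_norm, inv_mul_cancel₀ hv0.ne']
    · rw [map_smul, norm_smul, norm_inv, norm_norm]; field_simp
  constructor
  · rw [← div_le_iff₀ hv0]
    refine le_csSup ⟨‖S‖, ?_⟩ hmem
    rintro r ⟨w, hw, rfl⟩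
    simpa [hw] using S.le_opNorm w
  · rw [← le_div_iff₀ hv0]
    refine csInf_le ⟨0, ?_⟩ hmem
    rintro r ⟨w, hw, rfl⟩
    exact norm_nonneg _

theorem aux_sInf_pos {X : Type*} [NormedAddCommGroup X] [InnerProductSpace ℝ X]
    {N : ℕ} (S : EuclideanSpace ℝ (Fin N) →L[ℝ] X) (hS : ∀ v, S v = 0 → v = 0)
    (v : EuclideanSpace ℝ (Fin N)) (hv : ‖v‖ = 1) :
    0 < sInf {r : ℝ | ∃ v : EuclideanSpace ℝ (Fin N), ‖v‖ = 1 ∧ r = ‖S v‖} := by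
  obtain ⟨w, hw, hmin⟩ := (isCompact_sphere (0 : EuclideanSpace ℝ (Fin N)) 1).exists_isMinOn
    ⟨v, by simpa using hv⟩ (f := fun v => ‖S v‖) (by fun_prop)
  have hw1 : ‖w‖ = 1 := by simpa using hw
  have hpos : 0 < ‖S w‖ := by
    rw [norm_pos_iff]
    intro h
    rw [hS w h] at hw1
    simp at hw1
  refine hpos.trans_le (le_csInf ⟨_, v, hv, rfl⟩ ?_)
  rintro r ⟨u, hu, rfl⟩
  exact hmin (by simpa using hu)

/-- If `K : X → X` is a bounded operator with
⟨u, K v⟩ ≤ M_K ‖u‖‖v‖ and β_K‖u‖² ≤ ⟨u, K u⟩ for β_K > −1, then for linearly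
independent `q₁,…,q_N` the Galerkin matrix `(L̃_h)[i,j] = ⟨q_i, q_j + K q_j⟩`
is invertible with κ(L̃_h) ≤ ((1+M_K)/(1+β_K))·κ(Q)². -/
theorem fop_perturbed_identity_condition_number
    {X : Type*} [NormedAddCommGroup X] [InnerProductSpace ℝ X] [CompleteSpace X]
    (K : X →L[ℝ] X) (MK βK : ℝ) (hMK : 0 < MK) (hβK : -1 < βK)
    (hbound : ∀ u v : X, ⟪u, K v⟫ ≤ MK * ‖u‖ * ‖v‖)
    (hcoer : ∀ u : X, βK * ‖u‖ ^ 2 ≤ ⟪u, K u⟫)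
    {N : ℕ} (q : Fin N → X) (hq : LinearIndependent ℝ q)
    (Lh : Matrix (Fin N) (Fin N) ℝ)
    (hLh : ∀ i j, Lh i j = ⟪q i, q j + K (q j)⟫) :
    IsUnit Lh.det ∧ condNum Lh ≤ ((1 + MK) / (1 + βK)) * (kappaQ q) ^ 2 := by
  rcases Nat.eq_zero_or_pos N with hN | hN
  · subst hN
    refine ⟨by simp, ?_⟩
    have h0 : specNorm Lh = 0 := by
      unfold specNorm
      rw [norm_eq_zero]
      ext v i
      exact i.elim0
    have h1 : 0 < 1 + βK := by linarith
    rw [condNum, h0, zero_mul]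
    positivity
  let S : EuclideanSpace ℝ (Fin N) →L[ℝ] X :=
    LinearMap.toContinuousLinearMap
      { toFun := fun v => ∑ l, v l • q l
        map_add' := by intro u v; simp [add_smul, Finset.sum_add_distrib]
        map_smul' := by intro c v; simp [Finset.smul_sum, smul_smul] }
  have hSv : ∀ v, S v = ∑ l, v l • q l := fun v => rfl
  have hS : ∀ v, S v = 0 → v = 0 := by
    intro v h
    have := Fintype.linearIndependent_iff.mp hq (fun i => v i) h
    ext i
    simpa using this i
  have hMle : ∀ v, ‖S v‖ ≤ sigmaMax q * ‖v‖ := by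
    intro v
    by_cases hv : v = 0
    · simp [hv]
    · exact (aux_norm_le S v hv).1
  have hmle : ∀ v, sigmaMin q * ‖v‖ ≤ ‖S v‖ := by
    intro v
    by_cases hv : v = 0
    · simp [hv]
    · exact (aux_norm_le S v hv).2
  have hmpos : 0 < sigmaMin q :=
    aux_sInf_pos S hS (EuclideanSpace.single ⟨0, hN⟩ 1) (by simp)
  have hMpos : 0 ≤ sigmaMax q := by
    have h := hMle (EuclideanSpace.single ⟨0, hN⟩ 1)
    simp only [EuclideanSpace.norm_single, norm_one, mul_one] at h
    exact (norm_nonneg _).trans h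
  unfold kappaQ
  generalize sigmaMin q = m at *
  generalize sigmaMax q = s at *
  have h1β : 0 < 1 + βK := by linarith
  have hinner : ∀ u v, ⟪u, Matrix.toEuclideanCLM (𝕜 := ℝ) Lh v⟫ = ⟪S u, S v + K (S v)⟫ := by
    intro u v
    rw [Matrix.inner_toEuclideanCLM, hSv, hSv, map_sum, ← Finset.sum_add_distrib]
    simp only [sum_inner, dotProduct, Matrix.mulVec, Finset.mul_sum, inner_sum, hLh]
    rw [Finset.sum_comm]
    refine Finset.sum_congr rfl fun i _ => Finset.sum_congr rfl fun j _ => ?_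
    rw [map_smul, ← smul_add, real_inner_smul_left, real_inner_smul_right]
    ring
  have hup : ∀ v, ‖Matrix.toEuclideanCLM (𝕜 := ℝ) Lh v‖ ≤ (1 + MK) * s ^ 2 * ‖v‖ := by
    intro v
    have key : ∀ u, ⟪u, Matrix.toEuclideanCLM (𝕜 := ℝ) Lh v⟫
        ≤ (1 + MK) * s ^ 2 * ‖v‖ * ‖u‖ := by
      intro u
      rw [hinner, inner_add_right]
      have e1 := real_inner_le_norm (S u) (S v)
      have e2 := hbound (S u) (S v)
      have e3 : ‖S u‖ * ‖S v‖ ≤ (s * ‖u‖) * (s * ‖v‖) :=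
        mul_le_mul (hMle u) (hMle v) (norm_nonneg _) (by positivity)
      have e4 := mul_le_mul_of_nonneg_left e3 (by linarith : 0 ≤ 1 + MK)
      linarith
    have h := key (Matrix.toEuclideanCLM (𝕜 := ℝ) Lh v)
    rw [real_inner_self_eq_norm_mul_norm] at h
    rcases (norm_nonneg (Matrix.toEuclideanCLM (𝕜 := ℝ) Lh v)).eq_or_lt with h0 | h0
    · rw [← h0]; positivity
    · exact le_of_mul_le_mul_right h h0
  have hlow : ∀ v, (1 + βK) * m ^ 2 * ‖v‖ ≤ ‖Matrix.toEuclideanCLM (𝕜 := ℝ) Lh v‖ := by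
    intro v
    have e1 := real_inner_le_norm v (Matrix.toEuclideanCLM (𝕜 := ℝ) Lh v)
    rw [hinner, inner_add_right, real_inner_self_eq_norm_sq] at e1
    have e2 := hcoer (S v)
    have e3 : (m * ‖v‖) ^ 2 ≤ ‖S v‖ ^ 2 := pow_le_pow_left₀ (by positivity) (hmle v) 2
    have e4 := mul_le_mul_of_nonneg_left e3 h1β.le
    rcases (norm_nonneg v).eq_or_lt with h0 | h0
    · rw [← h0]; simp
    · refine le_of_mul_le_mul_left ?_ h0
      linarith
  have hc : 0 < (1 + βK) * m ^ 2 := by positivity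
  have hdet : IsUnit Lh.det := by
    rw [isUnit_iff_ne_zero]
    intro h
    obtain ⟨v, hv, hv0⟩ := Matrix.exists_mulVec_eq_zero_iff.mpr h
    have := hlow (WithLp.toLp 2 v)
    rw [Matrix.toEuclideanCLM_toLp, hv0, WithLp.toLp_zero, norm_zero] at this
    have hn : 0 < ‖WithLp.toLp 2 v‖ := norm_pos_iff.mpr (by simpa using hv)
    have := mul_pos hc hn
    linarith
  refine ⟨hdet, ?_⟩
  have hA : specNorm Lh ≤ (1 + MK) * s ^ 2 :=
    ContinuousLinearMap.opNorm_le_bound _ (by positivity) hup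
  have hB : specNorm Lh⁻¹ ≤ ((1 + βK) * m ^ 2)⁻¹ := by
    refine ContinuousLinearMap.opNorm_le_bound _ (by positivity) fun w => ?_
    have h := hlow (Matrix.toEuclideanCLM (𝕜 := ℝ) Lh⁻¹ w)
    rw [← ContinuousLinearMap.mul_apply, ← map_mul, Matrix.mul_nonsing_inv _ hdet, map_one,
      ContinuousLinearMap.one_apply] at h
    rw [inv_mul_eq_div, le_div_iff₀ hc]
    linarith
  calc condNum Lh ≤ ((1 + MK) * s ^ 2) * ((1 + βK) * m ^ 2)⁻¹ :=
        mul_le_mul hA hB (norm_nonneg _) (by positivity)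
    _ = (1 + MK) / (1 + βK) * (s / m) ^ 2 := by field_simp
end
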